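/- arXiv:1501.07340 — 2 statements merged into one kernel-verified Lean document; each statement's English description precedes it below -/
import Mathlib

section
/- Let X be a set equipped with a preorder ⪯ and let G be a class of functions X → [−1,1]. Fix β > 0 and suppose the ordered sequential fat-shattering dimension d = fat_β^o(G,X) is finite. Then for any n ≥ d and any ordered X-valued tree x of depth n, N_∞(G, β, x) ≤ (2en/β)^{fat_β^o(G,X)}. -/
/-- A `Z`-valued tree of depth `n`, encoded as a function of the whole path, is predictable:
`z_t(y)` depends only on `y_1,…,y_{t−1}`. -/
def Predictable {Z : Type*} (n : ℕ) (z : (Fin n → Bool) → Fin n → Z) : Prop :=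
  ∀ y y' : Fin n → Bool, ∀ t : Fin n, (∀ s : Fin n, s < t → y s = y' s) → z y t = z y' t

/-- An `X`-valued tree is ordered if its labels are nondecreasing (w.r.t. the preorder on
`X`) along every path. -/
def OrderedTree {X : Type*} [Preorder X] (n : ℕ) (x : (Fin n → Bool) → Fin n → X) : Prop :=
  ∀ (y : Fin n → Bool) (t : Fin n) (h : t.val + 1 < n), x y t ≤ x y ⟨t.val + 1, h⟩

/-- The tree `x` of depth `D` is `β`-shattered by `G` with witness tree `s`. -/
def ShatteredBy {X : Type*} (G : Set (X → ℝ)) (β : ℝ) (D : ℕ)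
    (x : (Fin D → Bool) → Fin D → X) (s : (Fin D → Bool) → Fin D → ℝ) : Prop :=
  Predictable D x ∧ Predictable D s ∧
    ∀ y : Fin D → Bool, ∃ f ∈ G, ∀ t : Fin D,
      (if y t then (1 : ℝ) else -1) * (f (x y t) - s y t) ≥ β / 2

/-- `V` is a sequential `γ`-cover (in `ℓ∞`) of `G` on the tree `x`. -/
def IsCoverOn {X : Type*} (n : ℕ) (G : Set (X → ℝ)) (x : (Fin n → Bool) → Fin n → X)
    (γ : ℝ) (V : Finset ((Fin n → Bool) → Fin n → ℝ)) : Prop :=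
  (∀ v ∈ V, Predictable n v) ∧
    ∀ f ∈ G, ∀ y : Fin n → Bool, ∃ v ∈ V, ∀ t : Fin n, |v y t - f (x y t)| ≤ γ

/-- The tree with root `r` whose subtrees after the outcomes `false`, `true` are `u false`,
`u true`. -/
def joinTree {Z : Type*} {n : ℕ} (r : Z) (u : Bool → (Fin n → Bool) → Fin n → Z) :
    (Fin (n + 1) → Bool) → Fin (n + 1) → Z :=
  fun y => Fin.cons r (u (y 0) (Fin.tail y))

/-- The subtree of `z` after the first outcome `b`. -/
def subtree {Z : Type*} {n : ℕ} (z : (Fin (n + 1) → Bool) → Fin (n + 1) → Z) (b : Bool) :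
    (Fin n → Bool) → Fin n → Z :=
  fun y t => z (Fin.cons b y) t.succ

lemma Predictable.joinTree {Z : Type*} {n : ℕ} {u : Bool → (Fin n → Bool) → Fin n → Z}
    (hu : ∀ b, Predictable n (u b)) (r : Z) : Predictable (n + 1) (joinTree r u) := by
  intro y y' t h
  cases t using Fin.cases with
  | zero => simp [_root_.joinTree]
  | succ t =>
    have h0 : y 0 = y' 0 := h 0 (Fin.succ_pos t)
    simp only [_root_.joinTree, Fin.cons_succ, h0]
    exact hu _ _ _ t fun s hs => h s.succ (Fin.succ_lt_succ_iff.2 hs)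

lemma Predictable.subtree {Z : Type*} {n : ℕ} {z : (Fin (n + 1) → Bool) → Fin (n + 1) → Z}
    (hz : Predictable (n + 1) z) (b : Bool) : Predictable n (subtree z b) := by
  intro y y' t h
  refine hz _ _ _ fun s hs => ?_
  cases s using Fin.cases with
  | zero => simp
  | succ s => simpa using h s (Fin.succ_lt_succ_iff.1 hs)

lemma OrderedTree.joinTree {X : Type*} [Preorder X] {n : ℕ}
    {u : Bool → (Fin n → Bool) → Fin n → X} (hu : ∀ b, OrderedTree n (u b)) {r : X}
    (hr : ∀ b y t, r ≤ u b y t) : OrderedTree (n + 1) (joinTree r u) := by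
  intro y t h
  cases t using Fin.cases with
  | zero => exact hr (y 0) (Fin.tail y) ⟨0, by simpa using h⟩
  | succ t => exact hu (y 0) (Fin.tail y) t (by simpa using h)

lemma OrderedTree.subtree {X : Type*} [Preorder X] {n : ℕ}
    {x : (Fin (n + 1) → Bool) → Fin (n + 1) → X} (hx : OrderedTree (n + 1) x) (b : Bool) :
    OrderedTree n (subtree x b) :=
  fun y t h => hx (Fin.cons b y) t.succ (by simpa using h)

lemma OrderedTree.zero_le {X : Type*} [Preorder X] {n : ℕ}
    {x : (Fin (n + 1) → Bool) → Fin (n + 1) → X} (hx : OrderedTree (n + 1) x)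
    (y : Fin (n + 1) → Bool) (t : Fin (n + 1)) : x y 0 ≤ x y t := by
  induction t using Fin.induction with
  | zero => exact le_rfl
  | succ t ih => exact ih.trans (hx y t.castSucc (by simp))

/-- Some ordered tree of depth `m` with labels in `S` is `β`-shattered by `G`. -/
def OrdShatters {X : Type*} [Preorder X] (S : Set X) (G : Set (X → ℝ)) (β : ℝ) (m : ℕ) : Prop :=
  ∃ (x : (Fin m → Bool) → Fin m → X) (s : (Fin m → Bool) → Fin m → ℝ),
    OrderedTree m x ∧ (∀ y t, x y t ∈ S) ∧ ShatteredBy G β m x s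

namespace OrdShatters

variable {X : Type*} [Preorder X] {S T : Set X} {G H : Set (X → ℝ)} {β : ℝ} {m : ℕ}

lemma mono (hST : S ⊆ T) (hGH : G ⊆ H) : OrdShatters S G β m → OrdShatters T H β m := by
  rintro ⟨x, s, hx, hS, hp, hs, h⟩
  refine ⟨x, s, hx, fun y t => hST (hS y t), hp, hs, fun y => ?_⟩
  obtain ⟨f, hf, h⟩ := h y
  exact ⟨f, hGH hf, h⟩

lemma nonempty (h : OrdShatters S G β m) : G.Nonempty := by
  obtain ⟨x, s, -, -, -, -, h⟩ := h
  obtain ⟨f, hf, -⟩ := h fun _ => false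
  exact ⟨f, hf⟩

lemma zero_of_nonempty (h : G.Nonempty) : OrdShatters S G β 0 := by
  obtain ⟨f, hf⟩ := h
  exact ⟨fun _ t => t.elim0, fun _ t => t.elim0, fun _ t => t.elim0, fun _ t => t.elim0,
    fun _ _ t => t.elim0, fun _ _ t => t.elim0, fun _ => ⟨f, hf, fun t => t.elim0⟩⟩

/-- Two classes separated by `β` at `r` whose trees lie above `r` combine to a deeper tree. -/
lemma join {r : X} (hr : r ∈ S) {G₀ G₁ : Set (X → ℝ)} (h₀ : OrdShatters (S ∩ Set.Ici r) G₀ β m)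
    (h₁ : OrdShatters (S ∩ Set.Ici r) G₁ β m) (hG₀ : G₀ ⊆ G) (hG₁ : G₁ ⊆ G) {c : ℝ}
    (hc₀ : ∀ f ∈ G₀, f r ≤ c - β / 2) (hc₁ : ∀ f ∈ G₁, c + β / 2 ≤ f r) :
    OrdShatters S G β (m + 1) := by
  obtain ⟨x₀, s₀, ho₀, hS₀, hx₀, hs₀, h₀⟩ := h₀
  obtain ⟨x₁, s₁, ho₁, hS₁, hx₁, hs₁, h₁⟩ := h₁
  have hS (b : Bool) (y t) : (bif b then x₁ else x₀) y t ∈ S ∩ Set.Ici r := by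
    cases b
    exacts [hS₀ y t, hS₁ y t]
  refine ⟨joinTree r fun b => bif b then x₁ else x₀, joinTree c fun b => bif b then s₁ else s₀,
    OrderedTree.joinTree (by simp [ho₀, ho₁]) fun b y t => (hS b y t).2, fun y t => ?_,
    Predictable.joinTree (by simp [hx₀, hx₁]) _, Predictable.joinTree (by simp [hs₀, hs₁]) _,
    fun y => ?_⟩
  · cases t using Fin.cases with
    | zero => exact hr
    | succ t => exact (hS (y 0) (Fin.tail y) t).1
  · cases hy : y 0 with
    | false =>
      obtain ⟨f, hf, h⟩ := h₀ (Fin.tail y)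
      refine ⟨f, hG₀ hf, fun t => ?_⟩
      cases t using Fin.cases with
      | zero =>
        have := hc₀ f hf
        simp only [joinTree, Fin.cons_zero, hy, Bool.false_eq_true, if_false]
        linarith
      | succ t =>
        simp only [joinTree, Fin.cons_succ, hy, cond_false]
        exact h t
    | true =>
      obtain ⟨f, hf, h⟩ := h₁ (Fin.tail y)
      refine ⟨f, hG₁ hf, fun t => ?_⟩
      cases t using Fin.cases with
      | zero =>
        have := hc₁ f hf
        simp only [joinTree, Fin.cons_zero, hy, if_true]
        linarith
      | succ t =>
        simp only [joinTree, Fin.cons_succ, hy, cond_true]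
        exact h t

end OrdShatters

/-- `G` has a sequential `γ`-cover on `x` indexed by `Fin N`. -/
def HasCover {X : Type*} (n : ℕ) (G : Set (X → ℝ)) (x : (Fin n → Bool) → Fin n → X)
    (γ : ℝ) (N : ℕ) : Prop :=
  ∃ v : Fin N → (Fin n → Bool) → Fin n → ℝ, (∀ j, Predictable n (v j)) ∧
    ∀ f ∈ G, ∀ y : Fin n → Bool, ∃ j, ∀ t : Fin n, |v j y t - f (x y t)| ≤ γ

namespace HasCover

variable {X : Type*} {n : ℕ} {G H : Set (X → ℝ)} {x : (Fin n → Bool) → Fin n → X} {γ : ℝ}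
  {M N : ℕ}

lemma mono (hGH : G ⊆ H) : HasCover n H x γ N → HasCover n G x γ N := by
  rintro ⟨v, hv, h⟩
  exact ⟨v, hv, fun f hf => h f (hGH hf)⟩

lemma empty : HasCover n ∅ x γ 0 :=
  ⟨fun j => j.elim0, fun j => j.elim0, fun _ hf => hf.elim⟩

lemma depth_zero {x : (Fin 0 → Bool) → Fin 0 → X} : HasCover 0 G x γ 1 :=
  ⟨fun _ _ t => t.elim0, fun _ _ _ t => t.elim0, fun _ _ _ => ⟨0, fun t => t.elim0⟩⟩

lemma union (hG : HasCover n G x γ M) (hH : HasCover n H x γ N) :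
    HasCover n (G ∪ H) x γ (M + N) := by
  obtain ⟨v, hv, hG⟩ := hG
  obtain ⟨w, hw, hH⟩ := hH
  refine ⟨Fin.append v w, fun j => ?_, ?_⟩
  · cases j using Fin.addCases with
    | left j => simpa using hv j
    | right j => simpa using hw j
  · rintro f (hf | hf) y
    · obtain ⟨j, h⟩ := hG f hf y
      exact ⟨Fin.castAdd N j, by simpa using h⟩
    · obtain ⟨j, h⟩ := hH f hf y
      exact ⟨Fin.natAdd M j, by simpa using h⟩

lemma iUnion {k : ℕ} {F : Fin k → Set (X → ℝ)} (hF : ∀ i, HasCover n (F i) x γ N) :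
    HasCover n (⋃ i, F i) x γ (k * N) := by
  choose v hv h using hF
  refine ⟨fun j => v j.divNat j.modNat, fun j => hv _ _, fun f hf y => ?_⟩
  obtain ⟨i, hi⟩ := Set.mem_iUnion.1 hf
  obtain ⟨j, hj⟩ := h i f hi y
  refine ⟨finProdFinEquiv (i, j), ?_⟩
  have e := finProdFinEquiv.symm_apply_apply (i, j)
  rw [finProdFinEquiv_symm_apply, Prod.mk.injEq] at e
  simpa only [e.1, e.2] using hj

lemma of_subtree {x : (Fin (n + 1) → Bool) → Fin (n + 1) → X}
    (h : ∀ b, HasCover n G (subtree x b) γ N) {c : ℝ}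
    (hc : ∀ f ∈ G, ∀ y, |c - f (x y 0)| ≤ γ) : HasCover (n + 1) G x γ N := by
  choose v hv h using h
  refine ⟨fun j => joinTree c fun b => v b j, fun j => Predictable.joinTree (fun b => hv b j) c,
    fun f hf y => ?_⟩
  obtain ⟨j, hj⟩ := h (y 0) f hf (Fin.tail y)
  refine ⟨j, fun t => ?_⟩
  cases t using Fin.cases with
  | zero => exact hc f hf y
  | succ t => simpa [joinTree, subtree] using hj t

end HasCover

/-- The Sauer-type bound: `coverBound k (d + 1) n = ∑ i ≤ d, n.choose i * k ^ i`. -/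
def coverBound (k : ℕ) : ℕ → ℕ → ℕ
  | 0, _ => 0
  | _ + 1, 0 => 1
  | m + 1, n + 1 => coverBound k (m + 1) n + k * coverBound k m n

lemma coverBound_le (k d n : ℕ) : coverBound k (d + 1) n ≤ (1 + k * n) ^ d := by
  induction n generalizing d with
  | zero => simp [coverBound]
  | succ n ih =>
    cases d with
    | zero => simpa [coverBound] using ih 0
    | succ d =>
      calc coverBound k (d + 1 + 1) (n + 1)
          = coverBound k (d + 1 + 1) n + k * coverBound k (d + 1) n := rfl
        _ ≤ (1 + k * n) ^ (d + 1) + k * (1 + k * n) ^ d := by gcongr <;> exact ih _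
        _ = (1 + k * n) ^ d * (1 + k * (n + 1)) := by ring
        _ ≤ (1 + k * (n + 1)) ^ d * (1 + k * (n + 1)) := by gcongr; omega
        _ = (1 + k * (n + 1)) ^ (d + 1) := by ring

/-- The functions of `G` whose value at `r` lies in the `i`-th interval of length `β` above `-1`. -/
def bin {X : Type*} (G : Set (X → ℝ)) (β : ℝ) (r : X) (i : ℕ) : Set (X → ℝ) :=
  {g ∈ G | ⌊(g r + 1) / β⌋₊ = i}

lemma le_and_lt_of_mem_bin {X : Type*} {G : Set (X → ℝ)}
    (hG : ∀ g ∈ G, ∀ x : X, g x ∈ Set.Icc (-1 : ℝ) 1) {β : ℝ} (hβ : 0 < β) {r : X} {i : ℕ}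
    {g : X → ℝ} (hg : g ∈ bin G β r i) : i * β - 1 ≤ g r ∧ g r < (i + 1) * β - 1 := by
  have h := (Nat.floor_eq_iff (div_nonneg (by linarith [(hG g hg.1 r).1]) hβ.le)).1 hg.2
  rw [le_div_iff₀ hβ, div_lt_iff₀ hβ] at h
  constructor <;> linarith [h.1, h.2]

lemma hasCover_coverBound {X : Type*} [Preorder X] {β : ℝ} (hβ : 0 < β) {n : ℕ} (m : ℕ)
    (S : Set X) (G : Set (X → ℝ)) (hG : ∀ g ∈ G, ∀ x : X, g x ∈ Set.Icc (-1 : ℝ) 1)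
    (hS : ¬ OrdShatters S G β m) (x : (Fin n → Bool) → Fin n → X) (hx : Predictable n x)
    (hxo : OrderedTree n x) (hxS : ∀ y t, x y t ∈ S) :
    HasCover n G x β (coverBound ⌊2 / β⌋₊ m n) := by
  induction n generalizing m S G with
  | zero =>
    cases m with
    | zero =>
      rw [Set.not_nonempty_iff_eq_empty.1 (mt OrdShatters.zero_of_nonempty hS)]
      exact HasCover.empty
    | succ m => exact HasCover.depth_zero
  | succ n ih =>
    cases m with
    | zero =>
      rw [Set.not_nonempty_iff_eq_empty.1 (mt OrdShatters.zero_of_nonempty hS)]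
      exact HasCover.empty
    | succ m =>
      set k := ⌊2 / β⌋₊
      set r := x (fun _ => false) 0
      have hr (y) : x y 0 = r := hx _ _ _ fun s hs => absurd hs (Fin.not_lt_zero s)
      have hrS : r ∈ S := hxS _ _
      have hsub (b y t) : subtree x b y t ∈ S ∩ Set.Ici r :=
        ⟨hxS _ _, by simpa [hr, subtree] using hxo.zero_le (Fin.cons b y) t.succ⟩
      have cover {F : Set (X → ℝ)} (hF : F ⊆ G) {p : ℕ}
          (hp : ¬ OrdShatters (S ∩ Set.Ici r) F β p) {c : ℝ} (hc : ∀ f ∈ F, |c - f r| ≤ β) :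
          HasCover (n + 1) F x β (coverBound k p n) :=
        HasCover.of_subtree (fun b => ih p _ F (fun g hg => hG g (hF hg)) hp _ (hx.subtree b)
          (hxo.subtree b) (hsub b)) fun f hf y => by rw [hr]; exact hc f hf
      have hbin (i) : bin G β r i ⊆ G := Set.sep_subset _ _
      have floor_le {g} (hg : g ∈ G) : ⌊(g r + 1) / β⌋₊ ≤ k :=
        Nat.floor_mono (by gcongr; linarith [(hG g hg r).2])
      set B := {i | OrdShatters (S ∩ Set.Ici r) (bin G β r i) β m}
      have hB {i j} (hi : i ∈ B) (hj : j ∈ B) : j < i + 2 := by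
        by_contra! hij
        refine hS (OrdShatters.join hrS hi hj (hbin i) (hbin j) (c := (i + 3 / 2) * β - 1)
          (fun f hf => ?_) fun f hf => ?_)
        · linarith [(le_and_lt_of_mem_bin hG hβ hf).2]
        · have : ((i : ℝ) + 2) * β ≤ j * β := by gcongr; exact_mod_cast hij
          linarith [(le_and_lt_of_mem_bin hG hβ hf).1]
      set a := sInf B
      have hak : a ≤ k := by
        rcases B.eq_empty_or_nonempty with h | h
        · simp [a, h]
        · obtain ⟨g, hg⟩ := OrdShatters.nonempty (Nat.sInf_mem h)
          exact hg.2.symm.trans_le (floor_le hg.1)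
      have ha {i} (hi : i ∈ B) : a ≤ i ∧ i < a + 2 := ⟨Nat.sInf_le hi, hB (Nat.sInf_mem ⟨i, hi⟩) hi⟩
      have big : HasCover (n + 1) (bin G β r a ∪ bin G β r (a + 1)) x β
          (coverBound k (m + 1) n) := by
        refine cover (Set.union_subset (hbin _) (hbin _))
          (mt (OrdShatters.mono Set.inter_subset_left (Set.union_subset (hbin _) (hbin _))) hS)
          (c := (a + 1) * β - 1) ?_
        rintro f (hf | hf) <;> have h := le_and_lt_of_mem_bin hG hβ hf <;>
          push_cast at h <;> rw [abs_le] <;> constructor <;> linarith [h.1, h.2]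
      have small {i} (hi : i ∉ B) : HasCover (n + 1) (bin G β r i) x β (coverBound k m n) := by
        refine cover (hbin i) hi (c := i * β - 1) fun f hf => ?_
        have h := le_and_lt_of_mem_bin hG hβ hf
        rw [abs_le]
        constructor <;> linarith [h.1, h.2]
      have rest : HasCover (n + 1)
          (⋃ j : Fin k, bin G β r (if (j : ℕ) < a then j else j + 2)) x β
          (k * coverBound k m n) := by
        refine HasCover.iUnion fun j => small fun hj => ?_
        have := ha hj
        split_ifs at this <;> omega
      refine (big.union rest).mono fun g hg => ?_
      have hgk := floor_le hg
      obtain ⟨i, hi⟩ : ∃ i, ⌊(g r + 1) / β⌋₊ = i := ⟨_, rfl⟩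
      have hgi : g ∈ bin G β r i := ⟨hg, hi⟩
      rw [hi] at hgk
      rcases lt_or_ge i a with h | h
      · refine Or.inr (Set.mem_iUnion.2 ⟨⟨i, by omega⟩, ?_⟩)
        simpa [h] using hgi
      · rcases lt_or_ge i (a + 2) with h' | h'
        · left
          obtain rfl | rfl : i = a ∨ i = a + 1 := by omega
          exacts [Or.inl hgi, Or.inr hgi]
        · refine Or.inr (Set.mem_iUnion.2 ⟨⟨i - 2, by omega⟩, ?_⟩)
          rwa [if_neg (by simp only; omega), Nat.sub_add_cancel (by omega)]

lemma ShatteredBy.le_two {X : Type*} {G : Set (X → ℝ)}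
    (hG : ∀ g ∈ G, ∀ x : X, g x ∈ Set.Icc (-1 : ℝ) 1) {β : ℝ} {d : ℕ}
    {x : (Fin (d + 1) → Bool) → Fin (d + 1) → X} {s : (Fin (d + 1) → Bool) → Fin (d + 1) → ℝ}
    (h : ShatteredBy G β (d + 1) x s) : β ≤ 2 := by
  obtain ⟨-, hs, h⟩ := h
  obtain ⟨f, hf, hf0⟩ := h fun _ => true
  obtain ⟨g, hg, hg0⟩ := h fun _ => false
  have e : s (fun _ => true) 0 = s (fun _ => false) 0 :=
    hs _ _ _ fun t ht => absurd ht (Fin.not_lt_zero t)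
  have h1 := hf0 0
  have h2 := hg0 0
  simp only [if_true, Bool.false_eq_true, if_false, ← e] at h1 h2
  linarith [(hG f hf (x (fun _ => true) 0)).2, (hG g hg (x (fun _ => false) 0)).1]

/-- covering-number bound via the ordered fat-shattering dimension. If
`d = fat_β^o(G,X)` is the largest depth of an ordered tree `β`-shattered by the
`[−1,1]`-valued class `G`, then on any ordered tree `x` of depth `n ≥ d` there is a
sequential `β`-cover of `G` of cardinality at most `(2en/β)^d`. -/
theorem stmt4 {X : Type*} [Preorder X]
    (G : Set (X → ℝ)) (hG : ∀ g ∈ G, ∀ x : X, g x ∈ Set.Icc (-1 : ℝ) 1)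
    (β : ℝ) (hβ : 0 < β) (d : ℕ)
    (hdim_ub : ∀ (D : ℕ) (x : (Fin D → Bool) → Fin D → X) (s : (Fin D → Bool) → Fin D → ℝ),
      OrderedTree D x → ShatteredBy G β D x s → D ≤ d)
    (hdim_att : ∃ (x : (Fin d → Bool) → Fin d → X) (s : (Fin d → Bool) → Fin d → ℝ),
      OrderedTree d x ∧ ShatteredBy G β d x s)
    (n : ℕ) (hn : d ≤ n)
    (x : (Fin n → Bool) → Fin n → X) (hx : Predictable n x) (hxo : OrderedTree n x) :
    ∃ V : Finset ((Fin n → Bool) → Fin n → ℝ),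
      IsCoverOn n G x β V ∧
        (V.card : ℝ) ≤ (2 * Real.exp 1 * n / β) ^ d := by
  obtain ⟨v, hv, hcov⟩ := hasCover_coverBound hβ (d + 1) Set.univ G hG
    (fun ⟨x, s, hxo, _, hs⟩ => absurd (hdim_ub _ x s hxo hs) (by omega)) x hx hxo (by simp)
  classical
  refine ⟨Finset.univ.image v, ⟨by simpa using hv, fun f hf y => ?_⟩, ?_⟩
  · obtain ⟨j, hj⟩ := hcov f hf y
    exact ⟨v j, by simp, hj⟩
  have hcard : ((Finset.univ.image v).card : ℝ) ≤ (1 + ⌊2 / β⌋₊ * n) ^ d := by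
    have := (Finset.card_image_le (s := Finset.univ) (f := v)).trans
      ((Finset.card_fin _).trans_le (coverBound_le ⌊2 / β⌋₊ d n))
    exact_mod_cast this
  refine hcard.trans ?_
  cases d with
  | zero => simp
  | succ d =>
    obtain ⟨x', s', -, hs'⟩ := hdim_att
    have hβ2 := hs'.le_two hG
    have hn1 : (1 : ℝ) ≤ n := by exact_mod_cast (Nat.succ_pos d).trans_le hn
    have h1 : 1 ≤ 2 / β := (one_le_div hβ).2 hβ2
    have hk : (⌊2 / β⌋₊ : ℝ) ≤ 2 / β := Nat.floor_le (by positivity)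
    have he : 2 ≤ Real.exp 1 := by linarith [Real.add_one_le_exp (1 : ℝ)]
    have hkn : 1 ≤ 2 / β * n := one_le_mul_of_one_le_of_one_le h1 hn1
    gcongr
    calc 1 + (⌊2 / β⌋₊ : ℝ) * n ≤ 2 / β * n + 2 / β * n := by gcongr
      _ = 2 * (2 / β * n) := by ring
      _ ≤ Real.exp 1 * (2 / β * n) := by gcongr
      _ = 2 * Real.exp 1 * n / β := by ring
end

section
/- Let n ≥ 1 and 0 < δ ≤ 1/2. For any finite nonempty set V of [−1,1]-valued trees of depth n, any [δ,1−δ]-valued tree p of depth n, and any c > 0, E_y max_{v ∈ V} [ Σ_{t=1}^n η(p_t(y), y_t)·v_t(y) − c·v_t(y)² ] ≤ log|V| / (δ · log(1 + c/2)), where E_y denotes expectation over y ∈ {0,1}^n drawn from the process y_t | y_1,…,y_{t−1} ∼ Bernoulli(p_t(y_1,…,y_{t−1})). -/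
/-- `η(p,a) = −1{a=1}/p + 1{a=0}/(1−p)`. -/
noncomputable def eta (p : ℝ) (a : Bool) : ℝ := if a then -1 / p else 1 / (1 - p)

/-- The probability of the path `y ∈ {0,1}^n` under the process
`y_t | y_1,…,y_{t−1} ∼ Bernoulli(p_t(y_1,…,y_{t−1}))`. -/
noncomputable def bweight (n : ℕ) (p : (Fin n → Bool) → Fin n → ℝ) (y : Fin n → Bool) : ℝ :=
  ∏ t : Fin n, (if y t then p y t else 1 - p y t)

/-- Splitting off the first coin of a path: a sum over paths of products of predictable factors. -/
theorem sum_prod_predictable_succ (n : ℕ) (w : Bool → (Fin (n + 1) → Bool) → Fin (n + 1) → ℝ)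
    (hw : ∀ a, Predictable (n + 1) (w a)) (y₀ : Fin (n + 1) → Bool) :
    ∑ y, ∏ t, w (y t) y t =
      ∑ b, w b y₀ 0 * ∑ y : Fin n → Bool, ∏ t, w (y t) (Fin.cons b y) t.succ := by
  rw [← (Fin.consEquiv fun _ => Bool).sum_comp, Fintype.sum_prod_type]
  refine Finset.sum_congr rfl fun b _ => ?_
  rw [Finset.mul_sum]
  refine Finset.sum_congr rfl fun y _ => ?_
  simp only [Fin.consEquiv_apply, Fin.prod_univ_succ, Fin.cons_zero, Fin.cons_succ]
  exact congrArg₂ (· * ·) (hw b _ _ 0 fun s hs => absurd hs (Fin.not_lt_zero s)) rfl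

theorem Predictable.tail {Z : Type*} {n : ℕ} {z : (Fin (n + 1) → Bool) → Fin (n + 1) → Z}
    (hz : Predictable (n + 1) z) (b : Bool) :
    Predictable n fun y t => z (Fin.cons b y) t.succ := by
  intro y y' t h
  refine hz _ _ _ fun s hs => ?_
  induction s using Fin.cases with
  | zero => simp
  | succ s => simpa using h s (Fin.succ_lt_succ_iff.mp hs)

/-- One-step conditional sums at most one give a total sum at most one. -/
theorem sum_prod_predictable_le_one (n : ℕ) (w : Bool → (Fin n → Bool) → Fin n → ℝ)
    (hw : ∀ a, Predictable n (w a)) (hnonneg : ∀ a y t, 0 ≤ w a y t)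
    (hsum : ∀ y t, ∑ a, w a y t ≤ 1) : ∑ y, ∏ t, w (y t) y t ≤ 1 := by
  induction n with
  | zero => simp
  | succ n ih =>
    rw [sum_prod_predictable_succ n w hw fun _ => true]
    refine le_trans (Finset.sum_le_sum fun b _ => ?_) (hsum (fun _ => true) 0)
    exact mul_le_of_le_one_right (hnonneg _ _ _)
      (ih (fun a y t => w a (Fin.cons b y) t.succ) (fun a => (hw a).tail b)
        (fun _ _ _ => hnonneg _ _ _) fun _ _ => hsum _ _)

/-- One-step conditional sums equal to one give a total sum equal to one. -/
theorem sum_prod_predictable_eq_one (n : ℕ) (w : Bool → (Fin n → Bool) → Fin n → ℝ)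
    (hw : ∀ a, Predictable n (w a)) (hsum : ∀ y t, ∑ a, w a y t = 1) :
    ∑ y, ∏ t, w (y t) y t = 1 := by
  induction n with
  | zero => simp
  | succ n ih =>
    rw [sum_prod_predictable_succ n w hw fun _ => true, ← hsum (fun _ => true) 0]
    refine Finset.sum_congr rfl fun b _ => ?_
    rw [ih (fun a y t => w a (Fin.cons b y) t.succ) (fun a => (hw a).tail b)
      fun _ _ => hsum _ _, mul_one]

theorem Predictable.comp {Z Z' : Type*} {n : ℕ} {z : (Fin n → Bool) → Fin n → Z}
    (hz : Predictable n z) (f : Z → Z') : Predictable n fun y t => f (z y t) :=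
  fun y y' t h => congrArg f (hz y y' t h)

theorem Predictable.prodMk {Z Z' : Type*} {n : ℕ} {z : (Fin n → Bool) → Fin n → Z}
    {z' : (Fin n → Bool) → Fin n → Z'} (hz : Predictable n z) (hz' : Predictable n z') :
    Predictable n fun y t => (z y t, z' y t) :=
  fun y y' t h => Prod.ext (hz y y' t h) (hz' y y' t h)

theorem bweight_nonneg {n : ℕ} {p : (Fin n → Bool) → Fin n → ℝ}
    (hp : ∀ y t, p y t ∈ Set.Icc (0 : ℝ) 1) (y : Fin n → Bool) : 0 ≤ bweight n p y := by
  refine Finset.prod_nonneg fun t _ => ?_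
  have := hp y t
  split_ifs
  exacts [this.1, sub_nonneg.2 this.2]

theorem sum_bweight {n : ℕ} {p : (Fin n → Bool) → Fin n → ℝ} (hp : Predictable n p) :
    ∑ y, bweight n p y = 1 :=
  sum_prod_predictable_eq_one n (fun a y t => if a then p y t else 1 - p y t)
    (fun a => hp.comp fun q => if a then q else 1 - q) (by simp)

/-- The second-order remainder of `exp` at `r * L` is at most `r ^ 2` times the one at `L`. -/
theorem Real.exp_mul_sub_le {r L : ℝ} (hr : |r| ≤ 1) (hL : 0 ≤ L) :
    Real.exp (r * L) - 1 - r * L ≤ r ^ 2 * (Real.exp L - 1 - L) := by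
  have key (x : ℝ) : HasSum (fun k : ℕ => x ^ (k + 2) / (k + 2).factorial)
      (Real.exp x - 1 - x) := by
    have h := NormedSpace.expSeries_div_hasSum_exp x
    rw [← Real.exp_eq_exp_ℝ, ← hasSum_nat_add_iff' 2] at h
    simpa [Finset.sum_range_succ, sub_sub] using h
  refine hasSum_le (fun k => ?_) (key (r * L)) ((key L).mul_left (r ^ 2))
  have hrk : r ^ k ≤ 1 :=
    (le_abs_self _).trans (by rw [abs_pow]; exact pow_le_one₀ (abs_nonneg r) hr)
  rw [mul_pow, ← mul_div_assoc]
  refine div_le_div_of_nonneg_right ?_ (Nat.cast_nonneg _)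
  refine mul_le_mul_of_nonneg_right ?_ (pow_nonneg hL _)
  rw [pow_add]
  exact mul_le_of_le_one_left (sq_nonneg r) hrk

/-- The offset moment generating function of a single `eta` step is at most one. -/
theorem sum_mul_exp_eta_le_one {δ q v c : ℝ} (hδ0 : 0 < δ) (hδ : δ ≤ 1 / 2)
    (hq : q ∈ Set.Icc δ (1 - δ)) (hv : v ∈ Set.Icc (-1 : ℝ) 1) (hc : 0 < c) :
    ∑ a : Bool, (if a then q else 1 - q) *
      Real.exp (δ * Real.log (1 + c / 2) * (eta q a * v - c * v ^ 2)) ≤ 1 := by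
  set L := Real.log (1 + c / 2) with hL
  have hLpos : 0 < L := Real.log_pos (by linarith)
  have hexp : Real.exp L = 1 + c / 2 := Real.exp_log (by linarith)
  have hq0 : 0 < q := hδ0.trans_le hq.1
  have hq1 : 0 < 1 - q := by linarith [hq.2]
  have habs : |v| ≤ 1 := abs_le.2 hv
  have hlog : c ≤ L * (c + 2) := by
    have h := Real.one_sub_inv_le_log_of_pos (show 0 < 1 + c / 2 by linarith)
    rw [← hL] at h
    have h2 : 1 - (1 + c / 2)⁻¹ = c / (c + 2) := by field_simp; ring
    rwa [h2, div_le_iff₀ (by linarith)] at h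
  have step {s : ℝ} (hs : 0 < s) (hδs : δ ≤ s) (u : ℝ) (hu : |u| ≤ 1) :
      s * Real.exp (δ / s * u * L) ≤
        s + δ * u * L + δ ^ 2 * u ^ 2 * (c / 2 - L) / s := by
    have hr : |δ / s * u| ≤ 1 := by
      rw [abs_mul, abs_of_pos (div_pos hδ0 hs)]
      exact mul_le_one₀ ((div_le_one hs).2 hδs) (abs_nonneg u) hu
    have h := mul_le_mul_of_nonneg_left (Real.exp_mul_sub_le hr hLpos.le) hs.le
    rw [hexp] at h
    have e1 : s * ((δ / s * u) ^ 2 * (1 + c / 2 - 1 - L)) =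
        δ ^ 2 * u ^ 2 * (c / 2 - L) / s := by field_simp; ring
    have e2 : s * (δ / s * u * L) = δ * u * L := by field_simp
    linarith [mul_sub s (Real.exp (δ / s * u * L) - 1) (δ / s * u * L),
      mul_sub s (Real.exp (δ / s * u * L)) 1]
  have h1 := step hq0 hq.1 (-v) (by rwa [abs_neg])
  have h2 := step hq1 (by linarith [hq.2]) v habs
  have hcL : 0 ≤ c / 2 - L := by
    have := Real.log_le_sub_one_of_pos (show 0 < 1 + c / 2 by linarith)
    linarith
  have hinv : δ * (1 / q + 1 / (1 - q)) ≤ 2 := by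
    have : 1 / q + 1 / (1 - q) = 1 / (q * (1 - q)) := by field_simp; ring
    rw [this, mul_one_div, div_le_iff₀ (mul_pos hq0 hq1)]
    nlinarith [mul_nonneg (sub_nonneg.2 hq.1) (sub_nonneg.2 hq.2)]
  have hsum : q * Real.exp (δ / q * (-v) * L) + (1 - q) * Real.exp (δ / (1 - q) * v * L) ≤
      1 + δ * L * (c * v ^ 2) := by
    have hvar : δ ^ 2 * (-v) ^ 2 * (c / 2 - L) / q + δ ^ 2 * v ^ 2 * (c / 2 - L) / (1 - q) ≤
        δ * L * (c * v ^ 2) := by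
      calc _ = δ * v ^ 2 * (c / 2 - L) * (δ * (1 / q + 1 / (1 - q))) := by ring
        _ ≤ δ * v ^ 2 * (c / 2 - L) * 2 := by gcongr
        _ = δ * v ^ 2 * (c - 2 * L) := by ring
        _ ≤ δ * v ^ 2 * (c * L) := by gcongr; linarith
        _ = _ := by ring
    linarith
  have hsplit : ∀ a : Bool, Real.exp (δ * L * (eta q a * v - c * v ^ 2)) =
      Real.exp (eta q a * v * δ * L) * Real.exp (-(δ * L * (c * v ^ 2))) := fun a => by
    rw [← Real.exp_add]; ring_nf
  simp only [hsplit, ← mul_assoc, ← Finset.sum_mul]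
  rw [Real.exp_neg, mul_inv_le_iff₀ (Real.exp_pos _), one_mul, Fintype.sum_bool]
  have e1 : eta q true * v * δ * L = δ / q * (-v) * L := by simp only [eta, if_true]; ring
  have e2 : eta q false * v * δ * L = δ / (1 - q) * v * L := by
    simp only [eta, Bool.false_eq_true, if_false]; ring
  rw [e1, e2]
  simp only [if_true, Bool.false_eq_true, if_false, ← mul_assoc] at hsum ⊢
  exact hsum.trans ((add_comm _ _).trans_le (Real.add_one_le_exp _))

/-- the offset finite-class maximal inequality. For any finite nonempty set `V`
of `[−1,1]`-valued trees of depth `n`, any `[δ,1−δ]`-valued tree `p`, and any `c > 0`,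
`E_y max_{v∈V} [Σ_t η(p_t(y),y_t)v_t(y) − c·v_t(y)²] ≤ log|V|/(δ·log(1+c/2))`. -/
theorem stmt6 (n : ℕ) (hn : 1 ≤ n) (δ : ℝ) (hδ0 : 0 < δ) (hδ : δ ≤ 1 / 2)
    (V : Finset ((Fin n → Bool) → Fin n → ℝ)) (hV : V.Nonempty)
    (hVtree : ∀ v ∈ V, Predictable n v)
    (hVval : ∀ v ∈ V, ∀ y t, v y t ∈ Set.Icc (-1 : ℝ) 1)
    (p : (Fin n → Bool) → Fin n → ℝ) (hp : Predictable n p)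
    (hpval : ∀ y t, p y t ∈ Set.Icc δ (1 - δ))
    (c : ℝ) (hc : 0 < c) :
    ∑ y : Fin n → Bool, bweight n p y *
        (V.sup' hV fun v => ∑ t : Fin n, (eta (p y t) (y t) * v y t - c * v y t ^ 2)) ≤
      Real.log V.card / (δ * Real.log (1 + c / 2)) := by
  set l := δ * Real.log (1 + c / 2) with hl
  have hlpos : 0 < l := mul_pos hδ0 (Real.log_pos (by linarith))
  set S : ((Fin n → Bool) → Fin n → ℝ) → (Fin n → Bool) → ℝ :=
    fun v y => ∑ t : Fin n, (eta (p y t) (y t) * v y t - c * v y t ^ 2) with hS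
  have hw : ∀ y, 0 ≤ bweight n p y := bweight_nonneg fun y t =>
    ⟨hδ0.le.trans (hpval y t).1, (hpval y t).2.trans (by linarith)⟩
  have hmgf : ∀ v ∈ V, ∑ y, bweight n p y * Real.exp (l * S v y) ≤ 1 := by
    intro v hv
    have h := sum_prod_predictable_le_one n
      (fun a y t => (if a then p y t else 1 - p y t) *
        Real.exp (l * (eta (p y t) a * v y t - c * v y t ^ 2)))
      (fun a => (hp.prodMk (hVtree v hv)).comp fun z =>
        (if a then z.1 else 1 - z.1) * Real.exp (l * (eta z.1 a * z.2 - c * z.2 ^ 2)))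
      (fun a y t => by
        have := hpval y t
        refine mul_nonneg ?_ (Real.exp_pos _).le
        split_ifs <;> linarith [this.1, this.2])
      (fun y t => sum_mul_exp_eta_le_one hδ0 hδ (hpval y t) (hVval v hv y t) hc)
    simpa only [Finset.prod_mul_distrib, ← Real.exp_sum, ← Finset.mul_sum, bweight, hS] using h
  have hN : (0 : ℝ) < V.card := by exact_mod_cast hV.card_pos
  have hmax : ∀ y, l * V.sup' hV (fun v => S v y) ≤
      Real.log V.card - 1 + (∑ v ∈ V, Real.exp (l * S v y)) / V.card := by
    intro y
    obtain ⟨u, hu, hmu⟩ := V.exists_mem_eq_sup' hV fun v => S v y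
    rw [hmu]
    have h1 := Real.add_one_le_exp (l * S u y - Real.log V.card)
    rw [Real.exp_sub, Real.exp_log hN] at h1
    have h2 : Real.exp (l * S u y) / V.card ≤ (∑ v ∈ V, Real.exp (l * S v y)) / V.card := by
      gcongr
      exact Finset.single_le_sum (f := fun v => Real.exp (l * S v y))
        (fun _ _ => (Real.exp_pos _).le) hu
    linarith
  rw [le_div_iff₀ hlpos]
  calc (∑ y, bweight n p y * V.sup' hV fun v => S v y) * l
      = ∑ y, bweight n p y * (l * V.sup' hV fun v => S v y) := by
        rw [Finset.sum_mul]; exact Finset.sum_congr rfl fun _ _ => by ring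
    _ ≤ ∑ y, bweight n p y *
          (Real.log V.card - 1 + (∑ v ∈ V, Real.exp (l * S v y)) / V.card) :=
        Finset.sum_le_sum fun y _ => mul_le_mul_of_nonneg_left (hmax y) (hw y)
    _ = Real.log V.card - 1 +
          (∑ v ∈ V, ∑ y, bweight n p y * Real.exp (l * S v y)) / V.card := by
        simp only [mul_add, Finset.sum_add_distrib, ← Finset.sum_mul, sum_bweight hp, one_mul,
          ← mul_div_assoc, ← Finset.sum_div, Finset.mul_sum]
        rw [Finset.sum_comm]
    _ ≤ Real.log V.card - 1 + (∑ v ∈ V, (1 : ℝ)) / V.card := by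
        gcongr with v hv
        exact hmgf v hv
    _ = Real.log V.card := by
        rw [Finset.sum_const, nsmul_one, div_self hN.ne']; ring
end
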